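/- Let F = Fₘ be the free group on m generators, H a complex Hilbert space, n ≥ 1, and φ : Sₙ → L(H) positive definite with φ(e) = I_H. If Φ and Φ' are two positive definite extensions of φ to all of F, both of which are maximal (n+1)-orthogonal, then Φ(s) = Φ'(s) for every s ∈ F with |s| = n+1 (so Φ and Φ' agree on S_{n+1}). -/

import Mathlib

open scoped ComplexOrder

/-- A bundled complex Hilbert space. -/
structure BundledHilbertSpace where
  carrier : Type
  [normed : NormedAddCommGroup carrier]
  [ips : InnerProductSpace ℂ carrier]
  [complete : CompleteSpace carrier]

attribute [instance] BundledHilbertSpace.normed BundledHilbertSpace.ips BundledHilbertSpace.complete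

/-- A function `φ` is *positive definite on `S`* (see the paper, Section 4). -/
def IsPosDefOn {m : ℕ} {H : Type*} [NormedAddCommGroup H] [InnerProductSpace ℂ H]
    (S : Set (FreeGroup (Fin m))) (φ : FreeGroup (Fin m) → H →L[ℂ] H) : Prop :=
  ∀ (k : ℕ) (s : Fin k → FreeGroup (Fin m)), (∀ i, s i ∈ S) →
    (∀ i j, (s i)⁻¹ * s j ∈ S) → ∀ h : Fin k → H,
    0 ≤ ∑ i, ∑ j, (inner ℂ (h i) (φ ((s i)⁻¹ * s j) (h j)) : ℂ)

/-- `K_Φ(Σ)`: the closed linear span of `{π(σ)Vh : σ ∈ Σ, h ∈ H}`. -/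
def naimarkSpan {m : ℕ} {H K : Type*} [NormedAddCommGroup H] [InnerProductSpace ℂ H]
    [NormedAddCommGroup K] [InnerProductSpace ℂ K] [CompleteSpace K]
    (π : FreeGroup (Fin m) →* unitary (K →L[ℂ] K)) (V : H →L[ℂ] K)
    (S : Set (FreeGroup (Fin m))) : Submodule ℂ K :=
  (Submodule.span ℂ
    {x : K | ∃ σ ∈ S, ∃ h : H, x = (π σ : K →L[ℂ] K) (V h)}).topologicalClosure

/-- `(K, π, V)` is a *minimal Naimark dilation* of `Φ`: `π` is a unitary representation,
`V` an isometry, `Φ(s) = V⋆ π(s) V` for all `s`, and `K` is the closed span of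
`{π(s)Vh}`. -/
def IsMinimalNaimark {m : ℕ} {H K : Type*}
    [NormedAddCommGroup H] [InnerProductSpace ℂ H] [CompleteSpace H]
    [NormedAddCommGroup K] [InnerProductSpace ℂ K] [CompleteSpace K]
    (Φ : FreeGroup (Fin m) → H →L[ℂ] H)
    (π : FreeGroup (Fin m) →* unitary (K →L[ℂ] K)) (V : H →L[ℂ] K) : Prop :=
  (∀ h : H, ‖V h‖ = ‖h‖) ∧
  (∀ s : FreeGroup (Fin m),
    Φ s = (ContinuousLinearMap.adjoint V).comp ((π s : K →L[ℂ] K).comp V)) ∧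
  naimarkSpan π V (Set.univ : Set (FreeGroup (Fin m))) = ⊤

/-- The dilation `(K, π, V)` is *maximal `(n+1)`-orthogonal*: for all `s, t` with
`|s⁻¹t| = n + 1`, putting `Σ = {r : max(|r⁻¹s|, |r⁻¹t|) ≤ n}`, the subspaces
`K(Σ ∪ {s}) ⊖ K(Σ)` and `K(Σ ∪ {t}) ⊖ K(Σ)` are mutually orthogonal. -/
def IsMaximalOrthogonal {m : ℕ} {H K : Type*}
    [NormedAddCommGroup H] [InnerProductSpace ℂ H]
    [NormedAddCommGroup K] [InnerProductSpace ℂ K] [CompleteSpace K] (n : ℕ)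
    (π : FreeGroup (Fin m) →* unitary (K →L[ℂ] K)) (V : H →L[ℂ] K) : Prop :=
  ∀ s t : FreeGroup (Fin m), FreeGroup.norm (s⁻¹ * t) = n + 1 →
    ∀ u v : K,
      u ∈ naimarkSpan π V
        ({r | FreeGroup.norm (r⁻¹ * s) ≤ n ∧ FreeGroup.norm (r⁻¹ * t) ≤ n} ∪ {s}) →
      (∀ w ∈ naimarkSpan π V
        {r | FreeGroup.norm (r⁻¹ * s) ≤ n ∧ FreeGroup.norm (r⁻¹ * t) ≤ n},
        (inner ℂ u w : ℂ) = 0) →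
      v ∈ naimarkSpan π V
        ({r | FreeGroup.norm (r⁻¹ * s) ≤ n ∧ FreeGroup.norm (r⁻¹ * t) ≤ n} ∪ {t}) →
      (∀ w ∈ naimarkSpan π V
        {r | FreeGroup.norm (r⁻¹ * s) ≤ n ∧ FreeGroup.norm (r⁻¹ * t) ≤ n},
        (inner ℂ v w : ℂ) = 0) →
      (inner ℂ u v : ℂ) = 0

lemma core_hilbert {ι K K' : Type*} [NormedAddCommGroup K] [InnerProductSpace ℂ K] [CompleteSpace K]
    [NormedAddCommGroup K'] [InnerProductSpace ℂ K'] [CompleteSpace K']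
    (g : ι → K) (g' : ι → K')
    (hg : ∀ i j, (inner ℂ (g i) (g j) : ℂ) = inner ℂ (g' i) (g' j))
    (x y : K) (x' y' : K')
    (hx : ∀ i, (inner ℂ (g i) x : ℂ) = inner ℂ (g' i) x')
    (hy : ∀ i, (inner ℂ (g i) y : ℂ) = inner ℂ (g' i) y') :
    ∃ p ∈ (Submodule.span ℂ (Set.range g)).topologicalClosure,
    ∃ p' ∈ (Submodule.span ℂ (Set.range g')).topologicalClosure,
      (x - p) ∈ ((Submodule.span ℂ (Set.range g)).topologicalClosure)ᗮ ∧
      (x' - p') ∈ ((Submodule.span ℂ (Set.range g')).topologicalClosure)ᗮ ∧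
      (inner ℂ p y : ℂ) = inner ℂ p' y' := by
  set G₀ : Submodule ℂ (K × K') := Submodule.span ℂ (Set.range fun i => (g i, g' i)) with hG₀
  set G := G₀.topologicalClosure with hG
  have hGc : IsClosed (G : Set (K × K')) := G₀.isClosed_topologicalClosure
  have hgG : ∀ i, (g i, g' i) ∈ G := fun i =>
    G₀.le_topologicalClosure (Submodule.subset_span ⟨i, rfl⟩)
  -- induction principle
  have ind : ∀ (z : K) (z' : K'), (∀ i, (inner ℂ (g i) z : ℂ) = inner ℂ (g' i) z') →
      ∀ a ∈ G, (inner ℂ a.1 z : ℂ) = inner ℂ a.2 z' := by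
    intro z z' hz a ha
    have hcl : IsClosed {a : K × K' | (inner ℂ a.1 z : ℂ) = inner ℂ a.2 z'} :=
      isClosed_eq (by fun_prop) (by fun_prop)
    refine closure_minimal (s := (G₀ : Set (K × K'))) ?_ hcl ha
    intro b hb
    induction hb using Submodule.span_induction with
    | mem b hb => obtain ⟨i, rfl⟩ := hb; exact hz i
    | zero => simp
    | add b c _ _ hb hc =>
      simp only [Set.mem_ofPred_eq] at hb hc ⊢
      simp [inner_add_left, hb, hc]
    | smul r b _ hb =>
      simp only [Set.mem_ofPred_eq] at hb ⊢
      simp [inner_smul_left, hb]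
  have hGG : ∀ a ∈ G, ∀ b ∈ G, (inner ℂ a.1 b.1 : ℂ) = inner ℂ a.2 b.2 := by
    intro a ha b hb
    refine ind _ _ (fun i => ?_) a ha
    have h := ind (g i) (g' i) (fun j => hg j i) b hb
    rw [← inner_conj_symm, h, inner_conj_symm]
  have hnorm : ∀ a ∈ G, ‖a.1‖ = ‖a.2‖ := by
    intro a ha
    have h := hGG a ha a ha
    rw [inner_self_eq_norm_sq_to_K, inner_self_eq_norm_sq_to_K] at h
    have h2 : ‖a.1‖ ^ 2 = ‖a.2‖ ^ 2 := by exact_mod_cast h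
    exact (sq_eq_sq₀ (norm_nonneg _) (norm_nonneg _)).1 h2
  have hM1 : ∀ a ∈ G, a.2 ∈ (Submodule.span ℂ (Set.range g')).topologicalClosure := by
    intro a ha
    have hcl : IsClosed {a : K × K' | a.2 ∈ (Submodule.span ℂ (Set.range g')).topologicalClosure} :=
      (Submodule.isClosed_topologicalClosure _).preimage continuous_snd
    refine closure_minimal (s := (G₀ : Set (K × K'))) ?_ hcl ha
    have : G₀ ≤ ((Submodule.span ℂ (Set.range g')).topologicalClosure).comap
        (LinearMap.snd ℂ K K') := by
      rw [hG₀, Submodule.span_le]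
      rintro _ ⟨i, rfl⟩
      exact Submodule.le_topologicalClosure _ (Submodule.subset_span ⟨i, rfl⟩)
    exact this
  have hM2 : ∀ p ∈ (Submodule.span ℂ (Set.range g)).topologicalClosure, ∃ p', (p, p') ∈ G := by
    have : CompleteSpace G := hGc.completeSpace_coe
    let f : G →ₗᵢ[ℂ] K :=
      { toLinearMap := (LinearMap.fst ℂ K K').comp G.subtype
        norm_map' := by
          rintro ⟨a, ha⟩
          have := hnorm a ha
          simp [Prod.norm_def, this] }
    have hcl : IsClosed (Set.range f) := f.isometry.isClosedEmbedding.isClosed_range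
    have hle : (Submodule.span ℂ (Set.range g)) ≤ LinearMap.range f.toLinearMap := by
      rw [Submodule.span_le]
      rintro _ ⟨i, rfl⟩
      exact ⟨⟨_, hgG i⟩, rfl⟩
    intro p hp
    obtain ⟨⟨⟨a, b⟩, hab⟩, rfl⟩ := closure_minimal (t := Set.range f) (fun z hz => hle hz) hcl hp
    exact ⟨b, hab⟩
  set M := (Submodule.span ℂ (Set.range g)).topologicalClosure with hM
  have : CompleteSpace M := (Submodule.isClosed_topologicalClosure _).completeSpace_coe
  have hp : x - M.starProjection x ∈ Mᗮ := Submodule.sub_starProjection_mem_orthogonal x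
  have hpM : M.starProjection x ∈ M := Submodule.starProjection_apply_mem _ x
  obtain ⟨p', hp'⟩ := hM2 _ hpM
  refine ⟨_, hpM, p', hM1 _ hp', hp, ?_, ind y y' hy _ hp'⟩
  have : ∀ i, (inner ℂ (g' i) (x' - p') : ℂ) = 0 := by
    intro i
    have h := hGG _ (hgG i) _ hp'
    simp only at h
    rw [inner_sub_right, ← hx, ← h, ← inner_sub_right]
    have hi : g i ∈ M := Submodule.le_topologicalClosure _ (Submodule.subset_span ⟨i, rfl⟩)
    exact Submodule.inner_right_of_mem_orthogonal hi hp
  rw [Submodule.orthogonal_closure, Submodule.mem_orthogonal]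
  intro b hb
  induction hb using Submodule.span_induction with
  | mem b hb => obtain ⟨i, rfl⟩ := hb; exact this i
  | zero => simp
  | add b c _ _ hb hc => simp [inner_add_left, hb, hc]
  | smul r b _ hb => simp [inner_smul_left, hb]

/-- Length of the longest common prefix. -/
def lcpLen {α : Type*} [DecidableEq α] : List α → List α → ℕ
  | a :: l, b :: l' => if a = b then lcpLen l l' + 1 else 0
  | _, _ => 0

lemma lcpLen_le_left {α : Type*} [DecidableEq α] (l l' : List α) : lcpLen l l' ≤ l.length := by
  induction l generalizing l' with
  | nil => simp [lcpLen]
  | cons a l ih =>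
    cases l' with
    | nil => simp [lcpLen]
    | cons b l' => simp only [lcpLen]; split_ifs <;> simp [ih]

lemma lcpLen_ultra {α : Type*} [DecidableEq α] (l₁ l₂ l₃ : List α) :
    min (lcpLen l₁ l₂) (lcpLen l₃ l₂) ≤ lcpLen l₁ l₃ := by
  induction l₁ generalizing l₂ l₃ with
  | nil => simp [lcpLen]
  | cons a l₁ ih =>
    cases l₂ with
    | nil => simp [lcpLen]
    | cons b l₂ =>
      cases l₃ with
      | nil => simp [lcpLen]
      | cons c l₃ =>
        have := ih l₂ l₃
        simp only [lcpLen]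
        split_ifs <;> first | omega | simp_all

lemma norm_mk_invRev_append {α : Type*} [DecidableEq α] (l l' : List (α × Bool))
    (h : FreeGroup.IsReduced l) (h' : FreeGroup.IsReduced l') :
    FreeGroup.norm (FreeGroup.mk (FreeGroup.invRev l ++ l')) + 2 * lcpLen l l'
      = l.length + l'.length := by
  have inv : ∀ l : List (α × Bool), FreeGroup.IsReduced l →
      FreeGroup.IsReduced (FreeGroup.invRev l) := by
    intro l hl
    rw [FreeGroup.isReduced_iff_reduce_eq] at hl ⊢
    rw [FreeGroup.reduce_invRev, hl]
  induction l generalizing l' with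
  | nil =>
    simp [lcpLen, FreeGroup.norm, h'.reduce_eq]
  | cons a l ih =>
    cases l' with
    | nil => simp [lcpLen, FreeGroup.norm, (inv _ h).reduce_eq]
    | cons b l' =>
      by_cases hab : a = b
      · subst hab
        have e : FreeGroup.mk (FreeGroup.invRev (a :: l) ++ a :: l') =
            FreeGroup.mk (FreeGroup.invRev l ++ l') := by
          have h1 : FreeGroup.mk (a :: l) = FreeGroup.mk [a] * FreeGroup.mk l := by
            simp [FreeGroup.mul_mk]
          have h2 : FreeGroup.mk (a :: l') = FreeGroup.mk [a] * FreeGroup.mk l' := by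
            simp [FreeGroup.mul_mk]
          rw [← FreeGroup.mul_mk, ← FreeGroup.inv_mk, ← FreeGroup.mul_mk, ← FreeGroup.inv_mk,
            h1, h2]
          group
        have := ih l' (h.infix ⟨[a], [], by simp⟩) (h'.infix ⟨[a], [], by simp⟩)
        rw [e]
        simp only [lcpLen, if_true, List.length_cons]
        omega
      · have hred : FreeGroup.IsReduced (FreeGroup.invRev (a :: l) ++ b :: l') := by
          have h1 := inv _ h
          have h2 : FreeGroup.invRev (a :: l) = FreeGroup.invRev l ++ [(a.1, !a.2)] := by
            simp [FreeGroup.invRev]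
          rw [h2] at h1 ⊢
          have h3 : FreeGroup.IsReduced ([(a.1, !a.2)] ++ (b :: l')) := by
            simp only [List.singleton_append, FreeGroup.isReduced_cons_cons]
            refine ⟨fun h4 => ?_, h'⟩
            obtain ⟨a1, a2⟩ := a
            obtain ⟨b1, b2⟩ := b
            simp only at h4
            subst h4
            cases a2 <;> cases b2 <;> simp_all
          exact FreeGroup.IsReduced.append_overlap h1 h3 (by simp)
        simp [lcpLen, hab, FreeGroup.norm, hred.reduce_eq]

lemma freeGroup_norm_inv_mul {α : Type*} [DecidableEq α] (x y : FreeGroup α) :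
    FreeGroup.norm (x⁻¹ * y) + 2 * lcpLen x.toWord y.toWord
      = FreeGroup.norm x + FreeGroup.norm y := by
  have := norm_mk_invRev_append x.toWord y.toWord FreeGroup.isReduced_toWord
    FreeGroup.isReduced_toWord
  rw [← FreeGroup.mul_mk, ← FreeGroup.inv_mk, FreeGroup.mk_toWord, FreeGroup.mk_toWord] at this
  exact this

lemma tree_diam {α : Type*} [DecidableEq α] {n : ℕ} (w r r' : FreeGroup α)
    (hw : FreeGroup.norm w = n + 1)
    (h1 : FreeGroup.norm r ≤ n) (h2 : FreeGroup.norm (r⁻¹ * w) ≤ n)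
    (h3 : FreeGroup.norm r' ≤ n) (h4 : FreeGroup.norm (r'⁻¹ * w) ≤ n) :
    FreeGroup.norm (r⁻¹ * r') ≤ n := by
  have a := freeGroup_norm_inv_mul r w
  have b := freeGroup_norm_inv_mul r' w
  have c := freeGroup_norm_inv_mul r r'
  have d := lcpLen_ultra r.toWord w.toWord r'.toWord
  omega

lemma naimark_gram {m : ℕ} {H K : Type*}
    [NormedAddCommGroup H] [InnerProductSpace ℂ H] [CompleteSpace H]
    [NormedAddCommGroup K] [InnerProductSpace ℂ K] [CompleteSpace K]
    {Φ : FreeGroup (Fin m) → H →L[ℂ] H}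
    {π : FreeGroup (Fin m) →* unitary (K →L[ℂ] K)} {V : H →L[ℂ] K}
    (hN : IsMinimalNaimark Φ π V) (s t : FreeGroup (Fin m)) (h k : H) :
    (inner ℂ ((π s : K →L[ℂ] K) (V h)) ((π t : K →L[ℂ] K) (V k)) : ℂ) =
      inner ℂ h (Φ (s⁻¹ * t) k) := by
  rw [hN.2.1]
  simp only [ContinuousLinearMap.comp_apply, ContinuousLinearMap.adjoint_inner_right]
  rw [map_mul, map_inv]
  have : ((((π s)⁻¹ * π t : unitary (K →L[ℂ] K))) : K →L[ℂ] K) (V k) =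
      (ContinuousLinearMap.adjoint (π s : K →L[ℂ] K)) ((π t : K →L[ℂ] K) (V k)) := rfl
  rw [this, ContinuousLinearMap.adjoint_inner_right]

lemma naimarkSpan_eq {m : ℕ} {H K : Type*} [NormedAddCommGroup H] [InnerProductSpace ℂ H]
    [NormedAddCommGroup K] [InnerProductSpace ℂ K] [CompleteSpace K]
    (π : FreeGroup (Fin m) →* unitary (K →L[ℂ] K)) (V : H →L[ℂ] K)
    (S : Set (FreeGroup (Fin m))) :
    naimarkSpan π V S = (Submodule.span ℂ
      (Set.range fun i : S × H => (π i.1 : K →L[ℂ] K) (V i.2))).topologicalClosure := by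
  unfold naimarkSpan
  congr 2
  ext x
  constructor
  · rintro ⟨σ, hσ, h, rfl⟩
    exact ⟨(⟨σ, hσ⟩, h), rfl⟩
  · rintro ⟨⟨⟨σ, hσ⟩, h⟩, rfl⟩
    exact ⟨σ, hσ, h, rfl⟩

lemma naimarkSpan_mono {m : ℕ} {H K : Type*} [NormedAddCommGroup H] [InnerProductSpace ℂ H]
    [NormedAddCommGroup K] [InnerProductSpace ℂ K] [CompleteSpace K]
    (π : FreeGroup (Fin m) →* unitary (K →L[ℂ] K)) (V : H →L[ℂ] K)
    {S T : Set (FreeGroup (Fin m))} (hST : S ⊆ T) : naimarkSpan π V S ≤ naimarkSpan π V T := by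
  refine Submodule.topologicalClosure_mono (Submodule.span_mono ?_)
  rintro x ⟨σ, hσ, h, rfl⟩
  exact ⟨σ, hST hσ, h, rfl⟩

lemma mem_naimarkSpan {m : ℕ} {H K : Type*} [NormedAddCommGroup H] [InnerProductSpace ℂ H]
    [NormedAddCommGroup K] [InnerProductSpace ℂ K] [CompleteSpace K]
    (π : FreeGroup (Fin m) →* unitary (K →L[ℂ] K)) (V : H →L[ℂ] K)
    {S : Set (FreeGroup (Fin m))} {σ : FreeGroup (Fin m)} (hσ : σ ∈ S) (h : H) :
    (π σ : K →L[ℂ] K) (V h) ∈ naimarkSpan π V S :=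
  Submodule.le_topologicalClosure _ (Submodule.subset_span ⟨σ, hσ, h, rfl⟩)

/-- In a maximal orthogonal dilation, `⟪x, y⟫ = ⟪p, y⟫` where `p` is the projection of `x`. -/
lemma inner_eq_of_maximal {m n : ℕ} {H K : Type*}
    [NormedAddCommGroup H] [InnerProductSpace ℂ H]
    [NormedAddCommGroup K] [InnerProductSpace ℂ K] [CompleteSpace K]
    {π : FreeGroup (Fin m) →* unitary (K →L[ℂ] K)} {V : H →L[ℂ] K}
    (hM : IsMaximalOrthogonal n π V) (s t : FreeGroup (Fin m))
    (hst : FreeGroup.norm (s⁻¹ * t) = n + 1) (h k : H) (p : K)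
    (hp : p ∈ naimarkSpan π V
      {r | FreeGroup.norm (r⁻¹ * s) ≤ n ∧ FreeGroup.norm (r⁻¹ * t) ≤ n})
    (hxp : (π s : K →L[ℂ] K) (V h) - p ∈ (naimarkSpan π V
      {r | FreeGroup.norm (r⁻¹ * s) ≤ n ∧ FreeGroup.norm (r⁻¹ * t) ≤ n})ᗮ) :
    (inner ℂ ((π s : K →L[ℂ] K) (V h)) ((π t : K →L[ℂ] K) (V k)) : ℂ) =
      inner ℂ p ((π t : K →L[ℂ] K) (V k)) := by
  have key := hM s t hst
  have hle := fun a : FreeGroup (Fin m) => naimarkSpan_mono π V (Set.subset_union_left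
    (s := {r | FreeGroup.norm (r⁻¹ * s) ≤ n ∧ FreeGroup.norm (r⁻¹ * t) ≤ n}) (t := {a}))
  have hs := mem_naimarkSpan π V
    (S := {r | FreeGroup.norm (r⁻¹ * s) ≤ n ∧ FreeGroup.norm (r⁻¹ * t) ≤ n} ∪ {s})
    (σ := s) (Or.inr rfl) h
  have ht := mem_naimarkSpan π V
    (S := {r | FreeGroup.norm (r⁻¹ * s) ≤ n ∧ FreeGroup.norm (r⁻¹ * t) ≤ n} ∪ {t})
    (σ := t) (Or.inr rfl) k
  have hcl : IsClosed (naimarkSpan π V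
      {r | FreeGroup.norm (r⁻¹ * s) ≤ n ∧ FreeGroup.norm (r⁻¹ * t) ≤ n} : Set K) :=
    Submodule.isClosed_topologicalClosure _
  generalize naimarkSpan π V
      {r | FreeGroup.norm (r⁻¹ * s) ≤ n ∧ FreeGroup.norm (r⁻¹ * t) ≤ n} = M at *
  have : CompleteSpace M := hcl.completeSpace_coe
  generalize (π s : K →L[ℂ] K) (V h) = x at *
  generalize (π t : K →L[ℂ] K) (V k) = y at *
  have hq : y - M.starProjection y ∈ Mᗮ := Submodule.sub_starProjection_mem_orthogonal y
  have hqM : M.starProjection y ∈ M := Submodule.starProjection_apply_mem _ y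
  have h0 := key (x - p) (y - M.starProjection y)
    (Submodule.sub_mem _ hs (hle s hp))
    (fun w hw => Submodule.inner_left_of_mem_orthogonal hw hxp)
    (Submodule.sub_mem _ ht (hle t hqM))
    (fun w hw => Submodule.inner_left_of_mem_orthogonal hw hq)
  rw [inner_sub_right, Submodule.inner_left_of_mem_orthogonal hqM hxp, sub_zero,
    inner_sub_left, sub_eq_zero] at h0
  exact h0


/-- Two maximal `(n+1)`-orthogonal positive definite extensions to `F`
of the same positive definite `φ : Sₙ → L(H)` (with `φ(e) = I`) agree on all words of
length `n + 1` (hence on `S_{n+1}`). -/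
theorem maximal_orthogonal_extensions_agree {m n : ℕ} (hn : 1 ≤ n)
    {H : Type*} [NormedAddCommGroup H] [InnerProductSpace ℂ H] [CompleteSpace H]
    (φ : FreeGroup (Fin m) → H →L[ℂ] H) (hφ1 : φ 1 = 1)
    (hφ : IsPosDefOn {s : FreeGroup (Fin m) | FreeGroup.norm s ≤ n} φ)
    (Φ Φ' : FreeGroup (Fin m) → H →L[ℂ] H)
    (hΦ : IsPosDefOn (Set.univ : Set (FreeGroup (Fin m))) Φ)
    (hΦ' : IsPosDefOn (Set.univ : Set (FreeGroup (Fin m))) Φ')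
    (hext : Set.EqOn Φ φ {s : FreeGroup (Fin m) | FreeGroup.norm s ≤ n})
    (hext' : Set.EqOn Φ' φ {s : FreeGroup (Fin m) | FreeGroup.norm s ≤ n})
    (hmax : ∃ (K : BundledHilbertSpace)
      (π : FreeGroup (Fin m) →* unitary (K.carrier →L[ℂ] K.carrier))
      (V : H →L[ℂ] K.carrier),
      IsMinimalNaimark Φ π V ∧ IsMaximalOrthogonal n π V)
    (hmax' : ∃ (K' : BundledHilbertSpace)
      (π' : FreeGroup (Fin m) →* unitary (K'.carrier →L[ℂ] K'.carrier))
      (V' : H →L[ℂ] K'.carrier),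
      IsMinimalNaimark Φ' π' V' ∧ IsMaximalOrthogonal n π' V') :
    ∀ s : FreeGroup (Fin m), FreeGroup.norm s = n + 1 → Φ s = Φ' s := by
  obtain ⟨K, π, V, hN, hM⟩ := hmax
  obtain ⟨K', π', V', hN', hM'⟩ := hmax'
  intro w hw
  have hagree : ∀ r : FreeGroup (Fin m), FreeGroup.norm r ≤ n → Φ r = Φ' r := fun r hr =>
    (hext hr).trans (hext' hr).symm
  have hst : FreeGroup.norm ((1 : FreeGroup (Fin m))⁻¹ * w) = n + 1 := by simpa using hw
  ext k
  refine ext_inner_left ℂ fun h => ?_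
  have e := naimark_gram hN 1 w h k
  have e' := naimark_gram hN' 1 w h k
  simp only [inv_one, one_mul] at e e'
  rw [← e, ← e']
  let S : Set (FreeGroup (Fin m)) :=
    {r | FreeGroup.norm (r⁻¹ * 1) ≤ n ∧ FreeGroup.norm (r⁻¹ * w) ≤ n}
  have hS1 : ∀ r ∈ S, FreeGroup.norm r ≤ n := by
    intro r hr
    have := hr.1
    rwa [mul_one, FreeGroup.norm_inv_eq] at this
  obtain ⟨p, hp, p', hp', ho, ho', hpp⟩ := core_hilbert
    (fun i : S × H => (π i.1 : K.carrier →L[ℂ] K.carrier) (V i.2))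
    (fun i : S × H => (π' i.1 : K'.carrier →L[ℂ] K'.carrier) (V' i.2))
    (by
      rintro ⟨⟨r, hr⟩, a⟩ ⟨⟨r', hr'⟩, b⟩
      simp only
      rw [naimark_gram hN, naimark_gram hN',
        hagree _ (tree_diam w r r' hw (hS1 r hr) hr.2 (hS1 r' hr') hr'.2)])
    ((π 1 : K.carrier →L[ℂ] K.carrier) (V h)) ((π w : K.carrier →L[ℂ] K.carrier) (V k))
    ((π' 1 : K'.carrier →L[ℂ] K'.carrier) (V' h)) ((π' w : K'.carrier →L[ℂ] K'.carrier) (V' k))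
    (by
      rintro ⟨⟨r, hr⟩, a⟩
      simp only
      rw [naimark_gram hN, naimark_gram hN', hagree _ hr.1])
    (by
      rintro ⟨⟨r, hr⟩, a⟩
      simp only
      rw [naimark_gram hN, naimark_gram hN', hagree _ hr.2])
  rw [← naimarkSpan_eq] at hp hp' ho ho'
  rw [inner_eq_of_maximal hM 1 w hst h k p hp ho, inner_eq_of_maximal hM' 1 w hst h k p' hp' ho',
    hpp]
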